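/- There exists a constant C > 0 such that for every n ≥ 2 and every initial load vector ℓ⁰ ∈ ℕⁿ with initial discrepancy Δ = maxᵢ ℓ⁰ᵢ − minᵢ ℓ⁰ᵢ ≥ 1: letting t = ⌈C·n·(log n + log Δ)⌉, the probability under the t-fold iterate of the one-step balancing kernel started from ℓ⁰ that the potential satisfies Φ(X_t) < n is at least 1 − 1/n². -/

import Mathlib

open scoped BigOperators

/-- `balance ℓ u v` replaces `ℓ u` by `⌈(ℓ u + ℓ v)/2⌉` and `ℓ v` by `⌊(ℓ u + ℓ v)/2⌋`. -/
noncomputable def balance {n : ℕ} (ℓ : Fin n → ℤ) (u v : Fin n) : Fin n → ℤ :=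
  fun i =>
    if i = u then ⌈(((ℓ u + ℓ v : ℤ) : ℚ)) / 2⌉
    else if i = v then ⌊(((ℓ u + ℓ v : ℤ) : ℚ)) / 2⌋
    else ℓ i

/-- The one-step balancing kernel: from state `ℓ`, pick an ordered pair `(u, v)` of distinct
nodes uniformly at random (each with probability `1/(n(n−1))`) and move to `balance ℓ u v`. -/
noncomputable def stepPMF {n : ℕ} (hn : 2 ≤ n) (ℓ : Fin n → ℤ) : PMF (Fin n → ℤ) :=
  (PMF.uniformOfFinset
      (Finset.univ.filter (fun p : Fin n × Fin n => p.1 ≠ p.2))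
      ⟨(⟨0, by omega⟩, ⟨1, by omega⟩), by
        simp [Finset.mem_filter, Fin.ext_iff]⟩).map
    (fun p => balance ℓ p.1 p.2)

/-- The distribution of the load vector after `t` steps of the balancing process
started from `ℓ0`. -/
noncomputable def iterPMF {n : ℕ} (hn : 2 ≤ n) (ℓ0 : Fin n → ℤ) : ℕ → PMF (Fin n → ℤ)
  | 0 => PMF.pure ℓ0
  | (t + 1) => (iterPMF hn ℓ0 t).bind (stepPMF hn)

/-- The quadratic potential of a load vector: its squared distance from the uniform load. -/
noncomputable def potential {n : ℕ} (ℓ : Fin n → ℤ) : ℝ :=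
  ∑ i, ((ℓ i : ℝ) - ((∑ j, ℓ j : ℤ) : ℝ) / n) ^ 2

lemma potential_nonneg {n : ℕ} (ℓ : Fin n → ℤ) : 0 ≤ potential ℓ :=
  Finset.sum_nonneg fun _ _ => sq_nonneg _

/-- The two loads produced by balancing keep the total and differ by `0` or `1`. -/
lemma ceil_floor_half (s : ℤ) :
    ⌈((s : ℤ) : ℚ) / 2⌉ + ⌊((s : ℤ) : ℚ) / 2⌋ = s ∧
      (⌈((s : ℤ) : ℚ) / 2⌉ = ⌊((s : ℤ) : ℚ) / 2⌋ ∨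
        ⌈((s : ℤ) : ℚ) / 2⌉ = ⌊((s : ℤ) : ℚ) / 2⌋ + 1) := by
  rcases Int.even_or_odd' s with ⟨k, rfl | rfl⟩
  · have h : (((2 * k : ℤ)) : ℚ) / 2 = (k : ℤ) := by push_cast; ring
    rw [h, Int.ceil_intCast, Int.floor_intCast]
    omega
  · have hc : ⌈(((2 * k + 1 : ℤ)) : ℚ) / 2⌉ = k + 1 := by
      rw [Int.ceil_eq_iff]; push_cast; constructor <;> linarith
    have hf : ⌊(((2 * k + 1 : ℤ)) : ℚ) / 2⌋ = k := by
      rw [Int.floor_eq_iff]; push_cast; constructor <;> linarith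
    rw [hc, hf]
    omega

lemma sum_comp_balance {n : ℕ} {M : Type*} [AddCommGroup M] (g : ℤ → M) (ℓ : Fin n → ℤ)
    {u v : Fin n} (h : u ≠ v) :
    ∑ i, g (balance ℓ u v i) = ∑ i, g (ℓ i) +
      (g ⌈(((ℓ u + ℓ v : ℤ) : ℚ)) / 2⌉ - g (ℓ u)) +
      (g ⌊(((ℓ u + ℓ v : ℤ) : ℚ)) / 2⌋ - g (ℓ v)) := by
  have key : ∀ i, g (balance ℓ u v i) = g (ℓ i) +
      (if i = u then g ⌈(((ℓ u + ℓ v : ℤ) : ℚ)) / 2⌉ - g (ℓ u) else 0) +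
      (if i = v then g ⌊(((ℓ u + ℓ v : ℤ) : ℚ)) / 2⌋ - g (ℓ v) else 0) := by
    intro i
    unfold balance
    by_cases hu : i = u
    · subst hu; simp [h]
    · by_cases hv : i = v
      · subst hv; simp [hu]
      · simp [hu, hv]
  simp only [key, Finset.sum_add_distrib, Finset.sum_ite_eq', Finset.mem_univ, if_true]

lemma sum_balance {n : ℕ} (ℓ : Fin n → ℤ) {u v : Fin n} (h : u ≠ v) :
    ∑ i, balance ℓ u v i = ∑ i, ℓ i := by
  have h1 := sum_comp_balance (fun x : ℤ => x) ℓ h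
  have h2 := (ceil_floor_half (ℓ u + ℓ v)).1
  linarith

lemma potential_balance {n : ℕ} (ℓ : Fin n → ℤ) {u v : Fin n} (h : u ≠ v) :
    potential (balance ℓ u v) = potential ℓ - ((ℓ u - ℓ v : ℤ) : ℝ) ^ 2 / 2 +
      ((⌈(((ℓ u + ℓ v : ℤ) : ℚ)) / 2⌉ - ⌊(((ℓ u + ℓ v : ℤ) : ℚ)) / 2⌋ : ℤ) : ℝ) ^ 2 / 2 := by
  have h1 := sum_comp_balance
    (fun x : ℤ => ((x : ℝ) - ((∑ j, ℓ j : ℤ) : ℝ) / n) ^ 2) ℓ h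
  have h2 := (ceil_floor_half (ℓ u + ℓ v)).1
  unfold potential
  rw [sum_balance ℓ h]
  rw [h1]
  generalize ⌈(((ℓ u + ℓ v : ℤ) : ℚ)) / 2⌉ = a at *
  generalize ⌊(((ℓ u + ℓ v : ℤ) : ℚ)) / 2⌋ = b at *
  have h3 : (a : ℝ) = ℓ u + ℓ v - b := by
    have : (a : ℝ) + b = ℓ u + ℓ v := by exact_mod_cast h2
    linarith
  push_cast
  rw [h3]
  ring

lemma potential_balance_le {n : ℕ} (ℓ : Fin n → ℤ) {u v : Fin n} (h : u ≠ v) :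
    potential (balance ℓ u v) ≤ potential ℓ := by
  rw [potential_balance ℓ h]
  have h2 := ceil_floor_half (ℓ u + ℓ v)
  generalize ⌈(((ℓ u + ℓ v : ℤ) : ℚ)) / 2⌉ = a at *
  generalize ⌊(((ℓ u + ℓ v : ℤ) : ℚ)) / 2⌋ = b at *
  have h3 : (a - b) ^ 2 ≤ (ℓ u - ℓ v) ^ 2 := by
    apply sq_le_sq.2
    rcases h2 with ⟨hs, hab | hab⟩
    · simp [hab]
    · have hd : ℓ u - ℓ v ≠ 0 := by omega
      have hab' : a - b = 1 := by omega
      rw [hab', abs_one]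
      exact Int.one_le_abs hd
  have h4 : ((a - b : ℤ) : ℝ) ^ 2 ≤ ((ℓ u - ℓ v : ℤ) : ℝ) ^ 2 := by exact_mod_cast h3
  linarith

lemma potential_balance_le_sub {n : ℕ} (ℓ : Fin n → ℤ) {u v : Fin n} (h : u ≠ v) :
    potential (balance ℓ u v) ≤ potential ℓ - (((ℓ u : ℝ) - ℓ v) ^ 2 - 1) / 2 := by
  rw [potential_balance ℓ h]
  rcases ceil_floor_half (ℓ u + ℓ v) with ⟨-, h2 | h2⟩
  all_goals
    rw [h2]
    push_cast
    linarith

lemma sum_sq_sub_eq_potential {n : ℕ} (hn : 2 ≤ n) (ℓ : Fin n → ℤ) :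
    ∑ u, ∑ v, ((ℓ u : ℝ) - ℓ v) ^ 2 = 2 * n * potential ℓ := by
  have hn0 : (n : ℝ) ≠ 0 := by positivity
  have h1 : ∀ u v, ((ℓ u : ℝ) - ℓ v) ^ 2 = (ℓ u : ℝ) ^ 2 - 2 * ℓ u * ℓ v + (ℓ v : ℝ) ^ 2 :=
    fun u v => by ring
  have h2 : ∀ i, ((ℓ i : ℝ) - ((∑ j, ℓ j : ℤ) : ℝ) / n) ^ 2 = (ℓ i : ℝ) ^ 2 -
      2 * (((∑ j, ℓ j : ℤ) : ℝ) / n) * ℓ i + (((∑ j, ℓ j : ℤ) : ℝ) / n) ^ 2 := fun i => by ring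
  unfold potential
  simp only [h1, h2, Finset.sum_add_distrib, Finset.sum_sub_distrib, ← Finset.mul_sum,
    ← Finset.sum_mul, Finset.sum_const, Finset.card_univ, Fintype.card_fin, nsmul_eq_mul]
  push_cast
  field_simp
  ring

lemma card_offDiag_fin {n : ℕ} (hn : 2 ≤ n) :
    (((Finset.univ.filter (fun p : Fin n × Fin n => p.1 ≠ p.2)).card : ℕ) : ℝ)
      = n * (n - 1) := by
  have : Finset.univ.filter (fun p : Fin n × Fin n => p.1 ≠ p.2)
      = (Finset.univ : Finset (Fin n)).offDiag := by
    ext p; simp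
  rw [this, Finset.offDiag_card, Finset.card_univ, Fintype.card_fin,
    Nat.cast_sub (by nlinarith)]
  push_cast
  ring

/-- While the potential is at least `n`, a balancing step contracts it on average. -/
lemma sum_potential_balance_le {n : ℕ} (hn : 2 ≤ n) (ℓ : Fin n → ℤ)
    (hℓ : (n : ℝ) ≤ potential ℓ) :
    ∑ p ∈ Finset.univ.filter (fun p : Fin n × Fin n => p.1 ≠ p.2),
        potential (balance ℓ p.1 p.2)
      ≤ (n * (n - 1)) * ((1 - 1 / (2 * n)) * potential ℓ) := by
  have hn' : (2 : ℝ) ≤ n := by exact_mod_cast hn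
  have hsq : ∑ p ∈ Finset.univ.filter (fun p : Fin n × Fin n => p.1 ≠ p.2),
      ((ℓ p.1 : ℝ) - ℓ p.2) ^ 2 = 2 * n * potential ℓ := by
    rw [← sum_sq_sub_eq_potential hn, ← Fintype.sum_prod_type']
    refine Finset.sum_filter_of_ne fun p _ hp h => hp ?_
    simp [h]
  calc _ ≤ ∑ p ∈ Finset.univ.filter (fun p : Fin n × Fin n => p.1 ≠ p.2),
        (potential ℓ + 1 / 2 - ((ℓ p.1 : ℝ) - ℓ p.2) ^ 2 / 2) := by
        refine Finset.sum_le_sum fun p hp => ?_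
        have := potential_balance_le_sub ℓ (Finset.mem_filter.1 hp).2
        linarith
    _ = (n * (n - 1)) * (potential ℓ + 1 / 2) - n * potential ℓ := by
        rw [Finset.sum_sub_distrib, ← Finset.sum_div, hsq, Finset.sum_const, nsmul_eq_mul,
          card_offDiag_fin hn]
        ring
    _ ≤ _ := by
        have : (n * (n - 1)) * ((1 - 1 / (2 * n)) * potential ℓ)
            = n * (n - 1) * potential ℓ - (n - 1) * potential ℓ / 2 := by
          field_simp
        rw [this]
        nlinarith

open Classical in
/-- The potential, set to `0` on the absorbing event that it is below `n`. -/
noncomputable def truncPotential {n : ℕ} (ℓ : Fin n → ℤ) : ENNReal :=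
  if potential ℓ < n then 0 else ENNReal.ofReal (potential ℓ)

lemma truncPotential_le {n : ℕ} (ℓ : Fin n → ℤ) :
    truncPotential ℓ ≤ ENNReal.ofReal (potential ℓ) := by
  unfold truncPotential
  split_ifs <;> simp

lemma PMF.tsum_bind_mul {α β : Type*} (p : PMF α) (q : α → PMF β) (f : β → ENNReal) :
    ∑' b, (p.bind q) b * f b = ∑' a, p a * ∑' b, q a b * f b := by
  simp only [PMF.bind_apply, ← ENNReal.tsum_mul_right, ← ENNReal.tsum_mul_left]
  rw [ENNReal.tsum_comm]
  simp only [mul_assoc]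

lemma PMF.tsum_pure_mul {α : Type*} (a : α) (f : α → ENNReal) :
    ∑' b, PMF.pure a b * f b = f a := by
  rw [tsum_eq_single a]
  · simp
  · intro b hb; simp [PMF.pure_apply, hb]

lemma PMF.tsum_map_mul {α β : Type*} (p : PMF α) (g : α → β) (f : β → ENNReal) :
    ∑' b, (p.map g) b * f b = ∑' a, p a * f (g a) := by
  rw [PMF.map, PMF.tsum_bind_mul]
  simp only [Function.comp_apply, PMF.tsum_pure_mul]

lemma PMF.tsum_uniformOfFinset_mul {α : Type*} (s : Finset α) (hs : s.Nonempty)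
    (f : α → ENNReal) :
    ∑' a, PMF.uniformOfFinset s hs a * f a = (s.card : ENNReal)⁻¹ * ∑ a ∈ s, f a := by
  rw [tsum_eq_sum (s := s), Finset.mul_sum]
  · exact Finset.sum_congr rfl fun a ha => by rw [PMF.uniformOfFinset_apply_of_mem hs ha]
  · intro a ha; rw [PMF.uniformOfFinset_apply_of_notMem hs ha, zero_mul]

/-- Markov's inequality for a probability mass function. -/
lemma PMF.mul_toOuterMeasure_le {α : Type*} (p : PMF α) (f : α → ENNReal) (c : ENNReal)
    (s : Set α) (h : ∀ a ∈ s, c ≤ f a) :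
    p.toOuterMeasure s * c ≤ ∑' a, p a * f a := by
  rw [PMF.toOuterMeasure_apply, ← ENNReal.tsum_mul_right]
  refine ENNReal.tsum_le_tsum fun a => ?_
  by_cases ha : a ∈ s
  · rw [Set.indicator_of_mem ha]
    gcongr
    exact h a ha
  · rw [Set.indicator_of_notMem ha, zero_mul]
    exact zero_le

lemma PMF.toOuterMeasure_add_compl {α : Type*} (p : PMF α) (s : Set α) :
    p.toOuterMeasure s + p.toOuterMeasure sᶜ = 1 := by
  rw [PMF.toOuterMeasure_apply, PMF.toOuterMeasure_apply, ← ENNReal.tsum_add, ← p.tsum_coe]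
  exact tsum_congr fun a => Set.indicator_self_add_compl_apply s p a

lemma tsum_stepPMF_mul_truncPotential_le {n : ℕ} (hn : 2 ≤ n) (ℓ : Fin n → ℤ) :
    ∑' x, stepPMF hn ℓ x * truncPotential x
      ≤ ENNReal.ofReal (1 - 1 / (2 * n)) * truncPotential ℓ := by
  have hn' : (2 : ℝ) ≤ n := by exact_mod_cast hn
  rw [stepPMF, PMF.tsum_map_mul]
  refine (PMF.tsum_uniformOfFinset_mul _ _ _).trans_le ?_
  by_cases hℓ : potential ℓ < n
  · have hz : ∀ p ∈ Finset.univ.filter (fun p : Fin n × Fin n => p.1 ≠ p.2),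
        truncPotential (balance ℓ p.1 p.2) = 0 := fun p hp =>
      if_pos ((potential_balance_le ℓ (Finset.mem_filter.1 hp).2).trans_lt hℓ)
    rw [Finset.sum_eq_zero hz, mul_zero]
    exact zero_le
  · have hr : 0 ≤ 1 - 1 / (2 * (n : ℝ)) := by
      rw [sub_nonneg, div_le_one (by positivity)]; linarith
    have hc : 0 < (n : ℝ) * (n - 1) := by nlinarith
    have htrunc : truncPotential ℓ = ENNReal.ofReal (potential ℓ) := if_neg hℓ
    have hcard : ((Finset.univ.filter (fun p : Fin n × Fin n => p.1 ≠ p.2)).card : ENNReal)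
        = ENNReal.ofReal (n * (n - 1)) := by
      rw [← card_offDiag_fin hn, ENNReal.ofReal_natCast]
    rw [htrunc, hcard, ← ENNReal.ofReal_mul hr,
      ENNReal.inv_mul_le_iff (ENNReal.ofReal_pos.2 hc).ne' ENNReal.ofReal_ne_top,
      ← ENNReal.ofReal_mul hc.le]
    calc _ ≤ ∑ p ∈ Finset.univ.filter (fun p : Fin n × Fin n => p.1 ≠ p.2),
          ENNReal.ofReal (potential (balance ℓ p.1 p.2)) :=
          Finset.sum_le_sum fun p _ => truncPotential_le _
      _ = ENNReal.ofReal (∑ p ∈ Finset.univ.filter (fun p : Fin n × Fin n => p.1 ≠ p.2),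
          potential (balance ℓ p.1 p.2)) :=
          (ENNReal.ofReal_sum_of_nonneg fun p _ => potential_nonneg _).symm
      _ ≤ _ := ENNReal.ofReal_le_ofReal (sum_potential_balance_le hn ℓ (not_lt.1 hℓ))

lemma tsum_iterPMF_mul_truncPotential_le {n : ℕ} (hn : 2 ≤ n) (ℓ0 : Fin n → ℤ) (t : ℕ) :
    ∑' x, iterPMF hn ℓ0 t x * truncPotential x
      ≤ ENNReal.ofReal (1 - 1 / (2 * n)) ^ t * truncPotential ℓ0 := by
  induction t with
  | zero => rw [iterPMF, PMF.tsum_pure_mul, pow_zero, one_mul]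
  | succ t ih =>
    rw [iterPMF, PMF.tsum_bind_mul]
    calc _ ≤ ∑' x, iterPMF hn ℓ0 t x *
          (ENNReal.ofReal (1 - 1 / (2 * n)) * truncPotential x) :=
          ENNReal.tsum_le_tsum fun x =>
            mul_le_mul_right (tsum_stepPMF_mul_truncPotential_le hn x) _
      _ = ENNReal.ofReal (1 - 1 / (2 * n)) *
          ∑' x, iterPMF hn ℓ0 t x * truncPotential x := by
          rw [← ENNReal.tsum_mul_left]
          exact tsum_congr fun x => by ring
      _ ≤ ENNReal.ofReal (1 - 1 / (2 * n)) *
          (ENNReal.ofReal (1 - 1 / (2 * n)) ^ t * truncPotential ℓ0) := by gcongr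
      _ = _ := by ring

lemma potential_le_of_abs_sub_le {n : ℕ} (hn : 2 ≤ n) (ℓ : Fin n → ℤ) (D : ℝ)
    (h : ∀ u v, |(ℓ u : ℝ) - ℓ v| ≤ D) : potential ℓ ≤ n * D ^ 2 := by
  have hn' : (0 : ℝ) < n := by positivity
  have h1 : ∑ u, ∑ v, ((ℓ u : ℝ) - ℓ v) ^ 2 ≤ ∑ _u : Fin n, ∑ _v : Fin n, D ^ 2 :=
    Finset.sum_le_sum fun u _ => Finset.sum_le_sum fun v _ =>
      sq_le_sq.2 ((h u v).trans (le_abs_self D))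
  rw [sum_sq_sub_eq_potential hn] at h1
  simp only [Finset.sum_const, Finset.card_univ, Fintype.card_fin, nsmul_eq_mul] at h1
  have h2 : 2 * potential ℓ ≤ n * D ^ 2 := by
    refine le_of_mul_le_mul_left ?_ hn'
    linarith
  linarith [potential_nonneg ℓ]

lemma one_sub_pow_mul_sq_le {n D : ℝ} (hn : 2 ≤ n) (hD : 1 ≤ D) {t : ℕ}
    (ht : 4 * n * (Real.log n + Real.log D) ≤ t) :
    (1 - 1 / (2 * n)) ^ t * D ^ 2 ≤ 1 / n ^ 2 := by
  have hn0 : 0 < n := by linarith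
  have hD0 : 0 < D := by linarith
  have h1 : (1 - 1 / (2 * n)) ^ t ≤ Real.exp (-(2 * Real.log n + 2 * Real.log D)) := by
    calc (1 - 1 / (2 * n)) ^ t ≤ Real.exp (-(1 / (2 * n))) ^ t := by
          refine pow_le_pow_left₀ ?_ (Real.one_sub_le_exp_neg _) t
          rw [sub_nonneg, div_le_one (by positivity)]; linarith
      _ = Real.exp (-(t / (2 * n))) := by
          rw [← Real.exp_nat_mul]; congr 1; ring
      _ ≤ _ := by
          rw [Real.exp_le_exp, neg_le_neg_iff, le_div_iff₀ (by positivity)]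
          linarith
  have h2 : Real.exp (-(2 * Real.log n + 2 * Real.log D)) = 1 / (n ^ 2 * D ^ 2) := by
    rw [Real.exp_neg, Real.exp_add, two_mul, two_mul, Real.exp_add, Real.exp_add,
      Real.exp_log hn0, Real.exp_log hD0, one_div, sq, sq]
  rw [h2] at h1
  calc _ ≤ 1 / (n ^ 2 * D ^ 2) * D ^ 2 := by gcongr
    _ = 1 / n ^ 2 := by field_simp

/-- **Phase 1.** There is a constant `C > 0` such that for every `n ≥ 2` and every initial
load vector `ℓ⁰ ∈ ℕⁿ` of initial discrepancy `Δ ≥ 1`, after `⌈C·n·(log n + log Δ)⌉` steps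
of the balancing process the potential `Φ(X_t) = ∑ i (X_t i − ā)²` is below `n` with
probability at least `1 − 1/n²`. -/
theorem phase_one_potential_below_n :
    ∃ C : ℝ, 0 < C ∧
      ∀ (n : ℕ) (hn : 2 ≤ n) (ℓ0 : Fin n → ℤ),
        (∀ i, 0 ≤ ℓ0 i) →
        ∀ Δ : ℤ,
          Δ = Finset.univ.sup' ⟨⟨0, by omega⟩, Finset.mem_univ _⟩ ℓ0
                - Finset.univ.inf' ⟨⟨0, by omega⟩, Finset.mem_univ _⟩ ℓ0 →
          1 ≤ Δ →
          ENNReal.ofReal (1 - 1 / (n : ℝ) ^ 2) ≤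
            (iterPMF hn ℓ0 ⌈C * n * (Real.log n + Real.log Δ)⌉₊).toOuterMeasure
              {ℓ | ∑ i, ((ℓ i : ℝ) - ((∑ j, ℓ j : ℤ) : ℝ) / n) ^ 2 < n} := by
  refine ⟨4, by norm_num, fun n hn ℓ0 _ Δ hΔ hΔ1 => ?_⟩
  have hn' : (2 : ℝ) ≤ n := by exact_mod_cast hn
  have hΔ' : (1 : ℝ) ≤ Δ := by exact_mod_cast hΔ1
  have hdiff : ∀ u v, |(ℓ0 u : ℝ) - ℓ0 v| ≤ Δ := by
    intro u v
    have hu := Finset.le_sup' ℓ0 (Finset.mem_univ u)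
    have hv := Finset.le_sup' ℓ0 (Finset.mem_univ v)
    have hu' := Finset.inf'_le ℓ0 (Finset.mem_univ u)
    have hv' := Finset.inf'_le ℓ0 (Finset.mem_univ v)
    have : |ℓ0 u - ℓ0 v| ≤ Δ := by rw [abs_le]; constructor <;> linarith
    exact_mod_cast this
  set t := ⌈4 * n * (Real.log n + Real.log Δ)⌉₊
  have hr : 0 ≤ 1 - 1 / (2 * (n : ℝ)) := by
    rw [sub_nonneg, div_le_one (by positivity)]; linarith
  set s : Set (Fin n → ℤ) :=
    {ℓ | ∑ i, ((ℓ i : ℝ) - ((∑ j, ℓ j : ℤ) : ℝ) / n) ^ 2 < n}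
  have hmarkov : (iterPMF hn ℓ0 t).toOuterMeasure sᶜ * (n : ENNReal)
      ≤ ENNReal.ofReal (1 / (n : ℝ) ^ 2) * (n : ENNReal) := by
    calc _ ≤ ∑' x, iterPMF hn ℓ0 t x * truncPotential x := by
          refine PMF.mul_toOuterMeasure_le _ _ _ _ fun ℓ hℓ => ?_
          have hℓ' : ¬ potential ℓ < n := hℓ
          rw [truncPotential, if_neg hℓ', ← ENNReal.ofReal_natCast]
          exact ENNReal.ofReal_le_ofReal (not_lt.1 hℓ')
      _ ≤ ENNReal.ofReal (1 - 1 / (2 * n)) ^ t * ENNReal.ofReal (n * (Δ : ℝ) ^ 2) := by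
          refine (tsum_iterPMF_mul_truncPotential_le hn ℓ0 t).trans ?_
          gcongr
          exact (truncPotential_le ℓ0).trans
            (ENNReal.ofReal_le_ofReal (potential_le_of_abs_sub_le hn ℓ0 Δ hdiff))
      _ = ENNReal.ofReal ((1 - 1 / (2 * n)) ^ t * (Δ : ℝ) ^ 2 * n) := by
          rw [← ENNReal.ofReal_pow hr, ← ENNReal.ofReal_mul (pow_nonneg hr t)]
          congr 1
          ring
      _ ≤ ENNReal.ofReal (1 / (n : ℝ) ^ 2 * n) := by
          refine ENNReal.ofReal_le_ofReal ?_
          gcongr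
          exact one_sub_pow_mul_sq_le hn' hΔ' (Nat.le_ceil _)
      _ = _ := by rw [ENNReal.ofReal_mul (by positivity), ENNReal.ofReal_natCast]
  have hcompl : (iterPMF hn ℓ0 t).toOuterMeasure sᶜ ≤ ENNReal.ofReal (1 / (n : ℝ) ^ 2) :=
    (ENNReal.mul_le_mul_iff_left (Nat.cast_ne_zero.2 (by omega))
      (ENNReal.natCast_ne_top n)).1 hmarkov
  rw [ENNReal.ofReal_sub _ (by positivity), ENNReal.ofReal_one, tsub_le_iff_right,
    ← PMF.toOuterMeasure_add_compl (iterPMF hn ℓ0 t) s]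
  gcongr
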